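/- Let k be a field, n ≥ 1, and let J ⊆ k[x_0,…,x_n] be a saturated Borel monomial ideal with Hilbert polynomial q of degree < n and Gotzmann partition (b_1,…,b_r), and suppose J is not equal to the lexicographic ideal L^q_n. Then the Hilbert polynomial of k[x_0,…,x_{n+1}]/(J·k[x_0,…,x_{n+1}]) is not equal to Σ_{j=1}^r C(t + (b_j+1) − (j−1), b_j+1); in fact their difference is a positive integer constant. -/

import Mathlib

/-- The polynomial binomial coefficient `C(t+a, b) ∈ ℚ[t]`. -/
noncomputable def polyBinom (a b : ℤ) : Polynomial ℚ :=
  if 0 ≤ b then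
    (Nat.factorial b.toNat : ℚ)⁻¹ •
      (descPochhammer ℚ b.toNat).comp (Polynomial.X + Polynomial.C (a : ℚ))
  else 0

/-- The Gotzmann expression `Σ_{j=1}^r C(t + b_j − (j−1), b_j)`. -/
noncomputable def gotzmannSum (r : ℕ) (b : Fin r → ℤ) : Polynomial ℚ :=
  ∑ j : Fin r, polyBinom (b j - ((j : ℕ) : ℤ)) (b j)

/-- The Macaulay–Hartshorne expression `Σ_{i=0}^d [C(t+i, i+1) − C(t+i−e_i, i+1)]`. -/
noncomputable def mhSum (d : ℕ) (e : Fin (d + 1) → ℤ) : Polynomial ℚ :=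
  ∑ i : Fin (d + 1),
    (polyBinom ((i : ℕ) : ℤ) (((i : ℕ) : ℤ) + 1) -
      polyBinom (((i : ℕ) : ℤ) - e i) (((i : ℕ) : ℤ) + 1))

/-- A monomial ideal: an ideal generated by a set of monomials. -/
def IsMonomialIdeal {k : Type*} [Field k] {N : ℕ} (I : Ideal (MvPolynomial (Fin N) k)) : Prop :=
  ∃ S : Set (Fin N →₀ ℕ), I = Ideal.span ((fun u => MvPolynomial.monomial u (1 : k)) '' S)

/-- `I` is Borel (strongly stable): for every monomial `x^u ∈ I`, every `j` with
`x_j ∣ x^u`, and every `i < j`, the monomial `x^u·x_i/x_j` lies in `I`. -/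
def IsBorel {k : Type*} [Field k] {N : ℕ} (I : Ideal (MvPolynomial (Fin N) k)) : Prop :=
  ∀ u : Fin N →₀ ℕ, MvPolynomial.monomial u (1 : k) ∈ I →
    ∀ j : Fin N, u j ≠ 0 → ∀ i : Fin N, i < j →
      MvPolynomial.monomial (u - Finsupp.single j 1 + Finsupp.single i 1) (1 : k) ∈ I

/-- `I` is saturated with respect to the irrelevant ideal `⟨x_0,…,x_n⟩`: every `f` with
`f·⟨x_0,…,x_n⟩^j ⊆ I` for some `j ≥ 1` lies in `I`. -/
def IsSaturatedIdeal {k : Type*} [Field k] {N : ℕ} (I : Ideal (MvPolynomial (Fin N) k)) : Prop :=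
  ∀ f : MvPolynomial (Fin N) k,
    (∃ j : ℕ, 1 ≤ j ∧
      ∀ g ∈ (Ideal.span (Set.range (MvPolynomial.X : Fin N → MvPolynomial (Fin N) k))) ^ j,
        f * g ∈ I) → f ∈ I

/-- The Hilbert function of `k[x_0,…,x_{N−1}]/I` in degree `i`: the `k`-dimension of the
degree-`i` homogeneous piece modulo the degree-`i` part of `I`. -/
noncomputable def hilbFn {k : Type*} [Field k] {N : ℕ} (I : Ideal (MvPolynomial (Fin N) k))
    (i : ℕ) : ℕ :=
  Module.finrank k
    ((MvPolynomial.homogeneousSubmodule (Fin N) k i) ⧸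
      (Submodule.comap (MvPolynomial.homogeneousSubmodule (Fin N) k i).subtype
        (Submodule.restrictScalars k I)))

/-- The sequence `e_0, …, e_d` extended by `e_i := 0` for `i > d`. -/
def eExt (d : ℕ) (e : Fin (d + 1) → ℤ) (i : ℕ) : ℤ :=
  if h : i ≤ d then e ⟨i, Nat.lt_succ_of_le h⟩ else 0

/-- `a_j := e_j − e_{j+1}` for the extended sequence. -/
def aSeq (d : ℕ) (e : Fin (d + 1) → ℤ) (j : ℕ) : ℕ :=
  (eExt d e j - eExt d e (j + 1)).toNat

/-- The exponent vector of the `m`-th generator (for `0 ≤ m ≤ n−1`) of `L(a_0,…,a_{n−1})`: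
for `m < n−1` it is `x_0^{a_{n−1}}⋯x_{m−1}^{a_{n−m}}·x_m^{a_{n−1−m}+1}`, and for
`m = n−1` it is `x_0^{a_{n−1}}⋯x_{n−2}^{a_1}·x_{n−1}^{a_0}`. -/
noncomputable def lexExp (n : ℕ) (a : ℕ → ℕ) (m : ℕ) : Fin (n + 1) →₀ ℕ :=
  Finsupp.equivFunOnFinite.symm fun t : Fin (n + 1) =>
    if (t : ℕ) < m then a (n - 1 - (t : ℕ))
    else if (t : ℕ) = m then (if m = n - 1 then a 0 else a (n - 1 - m) + 1)
    else 0

/-- The monomial ideal `L(a_0,…,a_{n−1}) ⊆ k[x_0,…,x_n]`. -/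
noncomputable def lexIdealGen (k : Type*) [Field k] (n : ℕ) (a : ℕ → ℕ) :
    Ideal (MvPolynomial (Fin (n + 1)) k) :=
  Ideal.span ((fun m => MvPolynomial.monomial (lexExp n a m) (1 : k)) '' {m : ℕ | m < n})

section PolyBinom

open Polynomial

theorem polyBinom_natCast (a : ℤ) (b : ℕ) :
    polyBinom a b = (Nat.factorial b : ℚ)⁻¹ • (descPochhammer ℚ b).comp (X + C (a : ℚ)) := by
  simp [polyBinom]

theorem polyBinom_of_neg (a : ℤ) {b : ℤ} (hb : b < 0) : polyBinom a b = 0 := by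
  simp [polyBinom, hb]

theorem polyBinom_zero (a : ℤ) : polyBinom a 0 = 1 := by
  simp [polyBinom]

theorem polyBinom_sub (a b : ℤ) :
    polyBinom (a + 1) b - polyBinom a b = polyBinom a (b - 1) := by
  rcases lt_trichotomy b 0 with hb | rfl | hb
  · rw [polyBinom_of_neg _ hb, polyBinom_of_neg _ hb, polyBinom_of_neg _ (by lia), sub_zero]
  · rw [polyBinom_zero, polyBinom_zero, polyBinom_of_neg _ (by lia), sub_self]
  · obtain ⟨m, rfl⟩ : ∃ m : ℕ, b = ((m + 1 : ℕ) : ℤ) := ⟨(b - 1).toNat, by lia⟩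
    have hb' : (((m + 1 : ℕ) : ℤ) - 1) = (m : ℕ) := by push_cast; ring
    rw [hb', polyBinom_natCast, polyBinom_natCast, polyBinom_natCast, ← smul_sub]
    have h1 : (descPochhammer ℚ (m + 1)).comp (X + C ((a + 1 : ℤ) : ℚ))
        = (X + C (a : ℚ) + 1) * (descPochhammer ℚ m).comp (X + C (a : ℚ)) := by
      rw [descPochhammer_succ_left, mul_comp, comp_assoc]
      simp [← add_assoc, sub_eq_add_neg]
    have h2 : (descPochhammer ℚ (m + 1)).comp (X + C (a : ℚ))
        = (descPochhammer ℚ m).comp (X + C (a : ℚ)) * (X + C (a : ℚ) - (m : ℚ[X])) := by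
      rw [descPochhammer_succ_right, mul_comp]
      simp
    have h3 : (X + C (a : ℚ) + 1) * (descPochhammer ℚ m).comp (X + C (a : ℚ))
        - (descPochhammer ℚ m).comp (X + C (a : ℚ)) * (X + C (a : ℚ) - (m : ℚ[X]))
        = ((m : ℚ) + 1) • (descPochhammer ℚ m).comp (X + C (a : ℚ)) := by
      rw [smul_eq_C_mul]
      simp only [map_add, map_natCast, map_one]
      ring
    rw [h1, h2, h3, smul_smul]
    congr 1
    have : (m.factorial : ℚ) ≠ 0 := by positivity
    push_cast [Nat.factorial_succ]
    field_simp

theorem polyBinom_natDegree (a : ℤ) (b : ℕ) : (polyBinom a b).natDegree ≤ b := by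
  rw [polyBinom_natCast]
  refine (natDegree_smul_le _ _).trans ?_
  rw [natDegree_comp, natDegree_X_add_C, descPochhammer_natDegree, mul_one]

theorem polyBinom_coeff_self (a : ℤ) (b : ℕ) :
    (polyBinom a b).coeff b = (Nat.factorial b : ℚ)⁻¹ := by
  have hm : ((descPochhammer ℚ b).comp (X + C (a : ℚ))).Monic :=
    (monic_descPochhammer ℚ b).comp_X_add_C _
  have hd : ((descPochhammer ℚ b).comp (X + C (a : ℚ))).natDegree = b := by
    rw [natDegree_comp, natDegree_X_add_C, descPochhammer_natDegree, mul_one]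
  have : ((descPochhammer ℚ b).comp (X + C (a : ℚ))).coeff b = 1 := by
    conv_lhs => rw [← hd]
    rw [hd]
    nth_rw 2 [← hd]
    exact hm.coeff_natDegree
  rw [polyBinom_natCast, coeff_smul, this, smul_eq_mul, mul_one]

theorem polyBinom_eval (a b m : ℕ) (h : a ≤ m) :
    (polyBinom ((b : ℤ) - a) b).eval (m : ℚ) = ((m - a + b).choose b : ℕ) := by
  rw [polyBinom_natCast, eval_smul, eval_comp, Nat.cast_choose_eq_descPochhammer_div]
  simp only [eval_add, eval_X, eval_C, smul_eq_mul]
  rw [div_eq_inv_mul]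
  congr 2
  push_cast [Nat.cast_sub h]
  ring

/-- The polynomial `Σ_{i<n} Σ_{E(i+1) ≤ s < E(i)} C(t - s + i + δ, i + δ)`. -/
noncomputable def lexPoly (E : ℕ → ℕ) (n : ℕ) (δ : ℤ) : ℚ[X] :=
  ∑ i ∈ Finset.range n, ∑ s ∈ Finset.Ico (E (i + 1)) (E i), polyBinom (i + δ - s) (i + δ)

theorem lexPoly_eq_of_le {E : ℕ → ℕ} {n K : ℕ} (h : n ≤ K) (hE : ∀ i, n ≤ i → E i = 0) (δ : ℤ) :
    lexPoly E n δ = lexPoly E K δ := by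
  unfold lexPoly
  refine Finset.sum_subset (Finset.range_subset_range.2 h) fun i _ hi => ?_
  simp only [Finset.mem_range, not_lt] at hi
  rw [hE i hi]
  simp

theorem lexPoly_coeff_eq_zero {E : ℕ → ℕ} {n m : ℕ} (h : n ≤ m) : (lexPoly E n 0).coeff m = 0 := by
  unfold lexPoly
  simp only [finsetSum_coeff, add_zero]
  refine Finset.sum_eq_zero fun i hi => Finset.sum_eq_zero fun s _ => ?_
  refine coeff_eq_zero_of_natDegree_lt ((polyBinom_natDegree _ i).trans_lt ?_)
  have := Finset.mem_range.1 hi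
  lia

theorem lexPoly_succ (E : ℕ → ℕ) (n : ℕ) (δ : ℤ) : lexPoly E (n + 1) δ = lexPoly E n δ +
    ∑ s ∈ Finset.Ico (E (n + 1)) (E n), polyBinom (n + δ - s) (n + δ) := by
  unfold lexPoly
  rw [Finset.sum_range_succ]

theorem lexPoly_coeff (E : ℕ → ℕ) (n : ℕ) : (lexPoly E (n + 1) 0).coeff n =
    ((E n - E (n + 1) : ℕ) : ℚ) * (Nat.factorial n : ℚ)⁻¹ := by
  rw [lexPoly_succ, coeff_add, lexPoly_coeff_eq_zero le_rfl, zero_add]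
  simp [polyBinom_coeff_self]

theorem lexPoly_injective {E E' : ℕ → ℕ} (hE : Antitone E) (hE' : Antitone E') (n : ℕ)
    (hn : ∀ i, n ≤ i → E i = E' i) (h : lexPoly E n 0 = lexPoly E' n 0) : E = E' := by
  induction n with
  | zero => exact funext fun i => hn i (Nat.zero_le _)
  | succ n ih =>
    have hs : E n = E' n := by
      have h0 := congrArg (fun p => p.coeff n) h
      simp only [lexPoly_coeff] at h0
      have h1 : ((E n - E (n + 1) : ℕ) : ℚ) = ((E' n - E' (n + 1) : ℕ) : ℚ) :=
        mul_right_cancel₀ (by positivity) h0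
      have h2 : E n - E (n + 1) = E' n - E' (n + 1) := by exact_mod_cast h1
      have := hn (n + 1) le_rfl
      have := hE (Nat.le_succ n)
      have := hE' (Nat.le_succ n)
      simp only [Nat.succ_eq_add_one] at *
      lia
    refine ih (fun i hi => ?_) ?_
    · rcases hi.eq_or_lt with rfl | hi
      · exact hs
      · exact hn i hi
    · rw [lexPoly_succ, lexPoly_succ, hs, hn (n + 1) le_rfl] at h
      exact add_right_cancel h

theorem sum_Ico_polyBinom (x y : ℕ) (h : x ≤ y) (c : ℤ) : ∑ s ∈ Finset.Ico x y, polyBinom (c - s) c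
    = polyBinom (c + 1 - x) (c + 1) - polyBinom (c + 1 - y) (c + 1) := by
  induction y, h using Nat.le_induction with
  | base => simp
  | succ y hy ih =>
    rw [Finset.sum_Ico_succ_top hy, ih]
    have := polyBinom_sub (c - y) (c + 1)
    rw [add_sub_cancel_right, show c - (y : ℤ) + 1 = c + 1 - y by ring] at this
    rw [← this]
    push_cast
    rw [show c + 1 - ((y : ℤ) + 1) = c - y by ring]
    ring

/-- A Macaulay–Hartshorne expression written as a lexicographic expression. -/
theorem sum_polyBinom_eq_lexPoly {E : ℕ → ℕ} (hE : Antitone E) (n : ℕ) :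
    ∑ i ∈ Finset.range n, (polyBinom i (i + 1) - polyBinom (i - E i) (i + 1))
      = lexPoly E n 0 + polyBinom (-E 0) 0 - polyBinom (n - E n) n
        + (polyBinom n n - polyBinom 0 0) := by
  induction n with
  | zero => simp [lexPoly]
  | succ n ih =>
    rw [Finset.sum_range_succ, ih, lexPoly_succ]
    simp only [add_zero]
    rw [sum_Ico_polyBinom _ _ (hE (Nat.le_succ n))]
    have h1 := polyBinom_sub (n - E n) (n + 1)
    have h2 := polyBinom_sub n (n + 1)
    rw [add_sub_cancel_right, show (n : ℤ) - E n + 1 = n + 1 - E n by ring] at h1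
    rw [add_sub_cancel_right] at h2
    rw [← h1, ← h2]
    push_cast
    simp only [Nat.succ_eq_add_one]
    ring

theorem mhSum_eq_lexPoly {n d : ℕ} (hdn : d < n) {e : Fin (d + 1) → ℤ}
    {E : ℕ → ℕ} (hE : Antitone E) (hEe : ∀ i, (E i : ℤ) = eExt d e i) :
    mhSum d e = lexPoly E n 0 := by
  have hz : ∀ i, d + 1 ≤ i → E i = 0 := fun i hi => by
    have := hEe i
    rw [eExt, dif_neg (by lia)] at this
    exact_mod_cast this
  rw [← lexPoly_eq_of_le (show d + 1 ≤ n by lia) hz]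
  have := sum_polyBinom_eq_lexPoly hE (d + 1)
  rw [hz (d + 1) le_rfl] at this
  rw [polyBinom_zero, polyBinom_zero] at this
  have h2 : mhSum d e =
      ∑ i ∈ Finset.range (d + 1), (polyBinom i (i + 1) - polyBinom (i - E i) (i + 1)) := by
    rw [mhSum, Finset.sum_range]
    refine Finset.sum_congr rfl fun i _ => ?_
    rw [hEe, eExt, dif_pos (by lia)]
  rw [h2, this]
  simp

theorem sum_fin_eq_sum_Ico {M : Type*} [AddCommMonoid M] {r : ℕ} {b : Fin r → ℕ} (hb : Antitone b)
    {K : ℕ} (hK : ∀ j, b j < K) (f : ℕ → ℕ → M) :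
    ∑ j : Fin r, f (b j) j = ∑ i ∈ Finset.range K,
      ∑ s ∈ Finset.Ico (Finset.card {j | i + 1 ≤ b j}) (Finset.card {j | i ≤ b j}), f i s := by
  have key : ∀ i (j : Fin r), i ≤ b j ↔ (j : ℕ) < Finset.card {j | i ≤ b j} := by
    intro i j
    constructor
    · intro h
      have : Finset.Iic j ⊆ ({j | i ≤ b j} : Finset (Fin r)) := fun x hx => by
        simp only [Finset.mem_filter, Finset.mem_univ, true_and]
        exact h.trans (hb (Finset.mem_Iic.1 hx))
      have := Finset.card_le_card this
      rw [Fin.card_Iic] at this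
      lia
    · intro h
      by_contra hc
      have : ({j | i ≤ b j} : Finset (Fin r)) ⊆ Finset.Iio j := fun x hx => by
        simp only [Finset.mem_filter, Finset.mem_univ, true_and] at hx
        rw [Finset.mem_Iio]
        by_contra hx'
        exact hc (hx.trans (hb (not_lt.1 hx')))
      have := Finset.card_le_card this
      rw [Fin.card_Iio] at this
      lia
  rw [← Finset.sum_fiberwise_of_maps_to (s := Finset.univ) (t := Finset.range K) (g := b)
    (fun j _ => Finset.mem_range.2 (hK j))]
  refine Finset.sum_congr rfl fun i _ => ?_
  refine Finset.sum_bij (fun j _ => (j : ℕ)) ?_ ?_ ?_ ?_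
  · intro j hj
    simp only [Finset.mem_filter, Finset.mem_univ, true_and] at hj
    rw [Finset.mem_Ico, ← key i j, ← not_lt, ← key (i + 1) j]
    lia
  · intro j _ j' _ h
    exact Fin.ext h
  · intro s hs
    rw [Finset.mem_Ico] at hs
    have hr : s < r := hs.2.trans_le ((Finset.card_le_univ _).trans (by simp))
    refine ⟨⟨s, hr⟩, ?_, rfl⟩
    have h1 := (key i ⟨s, hr⟩).2 hs.2
    have h2 := (key (i + 1) ⟨s, hr⟩).not.2 (not_lt.2 hs.1)
    simp only [Finset.mem_filter, Finset.mem_univ, true_and]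
    lia
  · intro j hj
    simp only [Finset.mem_filter, Finset.mem_univ, true_and] at hj
    rw [hj]

/-- A Gotzmann expression written as a lexicographic expression. -/
theorem exists_lexPoly_of_antitone {r : ℕ} {b : Fin r → ℤ} (hb : Antitone b) (hbnn : ∀ j, 0 ≤ b j) :
    ∃ (E : ℕ → ℕ) (K : ℕ), Antitone E ∧ (∀ i, K ≤ i → E i = 0) ∧
      ∀ δ : ℤ, ∑ j : Fin r, polyBinom (b j + δ - ((j : ℕ) : ℤ)) (b j + δ) = lexPoly E K δ := by
  have hb' : Antitone fun j => (b j).toNat := fun i j h => Int.toNat_le_toNat (hb h)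
  obtain ⟨K, hK⟩ : ∃ K, ∀ j, (b j).toNat < K :=
    ⟨(∑ j, (b j).toNat) + 1, fun j => Nat.lt_succ_of_le
      (Finset.single_le_sum (f := fun j => (b j).toNat) (fun _ _ => Nat.zero_le _)
        (Finset.mem_univ j))⟩
  refine ⟨fun i => Finset.card {j | i ≤ (b j).toNat}, K, ?_, ?_, ?_⟩
  · intro i i' h
    refine Finset.card_le_card fun j hj => ?_
    simp only [Finset.mem_filter, Finset.mem_univ, true_and] at hj ⊢
    exact h.trans hj
  · intro i hi
    rw [Finset.card_eq_zero, Finset.filter_eq_empty_iff]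
    intro j _
    exact not_le.2 ((hK j).trans_le hi)
  · intro δ
    have := sum_fin_eq_sum_Ico hb' hK fun i s => polyBinom ((i : ℤ) + δ - s) (i + δ)
    rw [lexPoly, ← this]
    refine Finset.sum_congr rfl fun j _ => ?_
    rw [Int.toNat_of_nonneg (hbnn j)]

end PolyBinom

section Rearrangement

open Polynomial

theorem sum_mul_by_parts {R : Type*} [CommRing R] (g f : ℕ → R) (k : ℕ) :
    ∑ s ∈ Finset.range k, g s * f s =
      ∑ s ∈ Finset.range k, (∑ u ∈ Finset.range (s + 1), g u) * (f s - f (s + 1))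
        + (∑ u ∈ Finset.range k, g u) * f k := by
  induction k with
  | zero => simp
  | succ k ih =>
    rw [Finset.sum_range_succ, ih, Finset.sum_range_succ (fun s => _ * _),
      Finset.sum_range_succ g]
    ring

/-- Replacing a multiset of degrees with multiplicities `v` by an interval of degrees. -/
theorem exists_rearrangement (v : ℕ → ℕ) (e c : ℕ) (hc : c = ∑ s ∈ Finset.range (e + c), v s)
    (hv : ∀ s, min (s + 1 - e) c ≤ ∑ u ∈ Finset.range (s + 1), v u) :
    ∃ w : ℕ → ℕ,
      (∀ f : ℕ → ℚ[X], ∑ s ∈ Finset.range (e + c), (v s : ℚ[X]) * f s =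
        ∑ s ∈ Finset.Ico e (e + c), f s +
          ∑ s ∈ Finset.range (e + c), (w s : ℚ[X]) * (f s - f (s + 1))) ∧
      ((∀ s < e + c, w s = 0) →
        ∀ s < e + c, v s = if e ≤ s then 1 else 0) := by
  have hcount : ∀ s, s ≤ e + c → ∑ u ∈ Finset.range s, (if e ≤ u then 1 else 0) = s - e := by
    intro s
    induction s with
    | zero => simp
    | succ s ih =>
      intro hs
      rw [Finset.sum_range_succ, ih (by lia)]
      split_ifs <;> lia
  have hw : ∀ s < e + c, ((∑ u ∈ Finset.range (s + 1), v u - min (s + 1 - e) c : ℕ) : ℤ) =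
      ∑ u ∈ Finset.range (s + 1), ((v u : ℤ) - ((if e ≤ u then 1 else 0 : ℕ) : ℤ)) := by
    intro s hs
    rw [Nat.cast_sub (hv s), min_eq_left (by lia), ← hcount (s + 1) (by lia)]
    push_cast
    rw [Finset.sum_sub_distrib]
  refine ⟨fun s => ∑ u ∈ Finset.range (s + 1), v u - min (s + 1 - e) c, fun f => ?_, fun h => ?_⟩
  · have key := sum_mul_by_parts
      (fun s => (((v s : ℤ) - ((if e ≤ s then 1 else 0 : ℕ) : ℤ) : ℤ) : ℚ[X])) f (e + c)
    have hz : ∑ u ∈ Finset.range (e + c),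
        (((v u : ℤ) - ((if e ≤ u then 1 else 0 : ℕ) : ℤ) : ℤ) : ℚ[X]) = 0 := by
      rw [← Int.cast_sum, Finset.sum_sub_distrib, ← Nat.cast_sum, ← Nat.cast_sum, ← hc,
        hcount _ le_rfl]
      simp
    rw [hz, zero_mul, add_zero] at key
    have h1 : ∑ s ∈ Finset.Ico e (e + c), f s =
        ∑ s ∈ Finset.range (e + c), ((if e ≤ s then 1 else 0 : ℕ) : ℚ[X]) * f s := by
      simp only [Nat.cast_ite, Nat.cast_one, Nat.cast_zero, ite_mul, one_mul, zero_mul]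
      rw [← Finset.sum_filter]
      refine Finset.sum_congr ?_ fun _ _ => rfl
      ext s
      simp only [Finset.mem_Ico, Finset.mem_filter, Finset.mem_range]
      tauto
    have h2 : ∀ s ∈ Finset.range (e + c),
        ((∑ u ∈ Finset.range (s + 1), v u - min (s + 1 - e) c : ℕ) : ℚ[X]) * (f s - f (s + 1)) =
        (∑ u ∈ Finset.range (s + 1),
          (((v u : ℤ) - ((if e ≤ u then 1 else 0 : ℕ) : ℤ) : ℤ) : ℚ[X])) * (f s - f (s + 1)) := by
      intro s hs
      rw [← Int.cast_sum, ← hw s (Finset.mem_range.1 hs)]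
      simp
    rw [Finset.sum_congr rfl h2, ← key, h1, ← Finset.sum_add_distrib]
    refine Finset.sum_congr rfl fun s _ => ?_
    push_cast
    ring
  · have hs0 : ∀ s ≤ e + c,
        ∑ u ∈ Finset.range s, ((v u : ℤ) - ((if e ≤ u then 1 else 0 : ℕ) : ℤ)) = 0 := by
      intro s hs
      cases s with
      | zero => simp
      | succ s =>
        rw [← hw s hs]
        exact_mod_cast h s hs
    intro s hs
    have h1 := hs0 s hs.le
    have h2 := hs0 (s + 1) hs
    rw [Finset.sum_range_succ, h1, zero_add] at h2
    lia

/-- A finite collection of `a i s` cells of dimension `i` and degree `s`, in which each cell of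
degree `s + 1` is accompanied by a cell of degree `s` and at least the same dimension, can be
exchanged for a lexicographic collection, up to cells of dimension one less than the minimum. -/
theorem exists_lexPoly_add (D n : ℕ) (a : ℕ → ℕ → ℕ) (ha : ∀ i, n ≤ i → ∀ s, a i s = 0)
    (haD : ∀ i s, D ≤ s → a i s = 0)
    (hchain : ∀ i s, a i (s + 1) ≠ 0 → ∃ i' ≥ i, a i' s ≠ 0) :
    ∃ (E w : ℕ → ℕ), Antitone E ∧ (∀ i, n ≤ i → E i = 0) ∧ (∀ i s, E 0 ≤ s → a i s = 0) ∧
      (∀ δ : ℤ, ∑ i ∈ Finset.range n, ∑ s ∈ Finset.range D,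
          (a i s : ℚ[X]) * polyBinom (i + δ - s) (i + δ) =
        lexPoly E n δ +
          ∑ s ∈ Finset.range (E 0), (w s : ℚ[X]) * polyBinom (δ - 1 - s) (δ - 1)) ∧
      ((∀ s < E 0, w s = 0) → ∀ i s, a i s = if E (i + 1) ≤ s ∧ s < E i then 1 else 0) := by
  induction n generalizing a with
  | zero =>
    refine ⟨fun _ => 0, fun _ => 0, antitone_const, fun _ _ => rfl, fun i s _ => ha i (by lia) s,
      fun δ => by simp [lexPoly], fun _ i s => by simp [ha i (by lia) s]⟩
  | succ n ih =>
    obtain ⟨E, w, hE, hEz, hsupp, hid, heq⟩ := ih (fun i => a (i + 1))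
      (fun i hi s => ha _ (by lia) s) (fun i s hs => haD _ s hs) (fun i s h => by
        obtain ⟨i', hi', h'⟩ := hchain _ _ h
        obtain ⟨i'', rfl⟩ : ∃ j, i' = j + 1 := ⟨i' - 1, by lia⟩
        exact ⟨i'', by lia, h'⟩)
    set v : ℕ → ℕ := fun s => a 0 s + if s < E 0 then w s else 0 with hvdef
    set B := max D (E 0) with hB
    set c := ∑ s ∈ Finset.range B, v s with hcdef
    have hpres : ∀ s, a 0 s ≠ 0 → ∀ u, E 0 ≤ u → u ≤ s → a 0 u ≠ 0 := by
      intro s hs u hu hus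
      induction s, hus using Nat.le_induction with
      | base => exact hs
      | succ s hs' ih' =>
        refine ih' ?_
        obtain ⟨i', -, h'⟩ := hchain 0 s hs
        cases i' with
        | zero => exact h'
        | succ i' => exact absurd (hsupp i' s (by lia)) h'
    have hvB : ∀ s, B ≤ s → v s = 0 := by
      intro s hs
      simp only [hvdef]
      rw [haD 0 s (by lia), if_neg (by lia)]
    have hpartial : ∀ s, (∀ u, s ≤ u → v u = 0) → ∑ u ∈ Finset.range s, v u = c := by
      intro s hs
      rcases le_total s B with h | h
      · exact Finset.sum_subset (Finset.range_subset_range.2 h) fun u _ hu =>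
          hs u (by simpa using hu)
      · exact (Finset.sum_subset (Finset.range_subset_range.2 h) fun u _ hu =>
          hvB u (by simpa using hu)).symm
    have hint : ∀ s, a 0 s ≠ 0 → ∀ u ≤ s, u + 1 - E 0 ≤ ∑ t ∈ Finset.range (u + 1), v t := by
      intro s hs u hu
      have h1 : ∑ t ∈ Finset.Ico (E 0) (u + 1), 1 ≤ ∑ t ∈ Finset.Ico (E 0) (u + 1), v t := by
        refine Finset.sum_le_sum fun t ht => ?_
        rw [Finset.mem_Ico] at ht
        have := hpres s hs t ht.1 (by lia)
        simp only [hvdef]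
        lia
      refine le_trans (by simp) (h1.trans (Finset.sum_le_sum_of_subset ?_))
      intro t ht
      simp only [Finset.mem_Ico, Finset.mem_range] at ht ⊢
      exact ht.2
    have hle : ∀ s, ∑ u ∈ Finset.range s, v u ≤ c := by
      intro s
      rw [← hpartial (max s B) (fun u hu => hvB u (by lia))]
      exact Finset.sum_le_sum_of_subset (Finset.range_subset_range.2 (le_max_left _ _))
    have ha0 : ∀ s, E 0 + c ≤ s → a 0 s = 0 := by
      intro s hs
      by_contra h
      have := hint s h s le_rfl
      have := hle (s + 1)
      lia
    have hv0 : ∀ s, E 0 + c ≤ s → v s = 0 := by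
      intro s hs
      simp only [hvdef]
      rw [ha0 s hs, if_neg (by lia)]
    obtain ⟨w', hw', hw'z⟩ := exists_rearrangement v (E 0) c (hpartial _ hv0).symm (by
      intro s
      by_cases h : ∃ u, s < u ∧ a 0 u ≠ 0
      · obtain ⟨u, hu, hau⟩ := h
        exact (min_le_left _ _).trans (hint u hau s hu.le)
      · push Not at h
        rcases lt_or_ge s (E 0) with hs | hs
        · simp [Nat.sub_eq_zero_of_le hs]
        · rw [hpartial (s + 1)]
          · exact min_le_right _ _
          · intro u hu
            simp only [hvdef]
            rw [h u hu, if_neg (by lia)])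
    refine ⟨fun i => Nat.casesOn i (E 0 + c) E, w', ?_, ?_, ?_, ?_, ?_⟩
    · refine antitone_nat_of_succ_le fun i => ?_
      cases i with
      | zero => exact Nat.le_add_right _ _
      | succ i => exact hE (Nat.le_succ i)
    · intro i hi
      cases i with
      | zero => lia
      | succ i => exact hEz i (by lia)
    · intro i s hs
      cases i with
      | zero => exact ha0 s hs
      | succ i => exact hsupp i s (le_trans (Nat.le_add_right _ _) hs)
    · intro δ
      have h1 := hid (δ + 1)
      have h2 := hw' fun s => polyBinom (δ - s) δ
      have hL : lexPoly (fun i => Nat.casesOn i (E 0 + c) E) (n + 1) δ =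
          lexPoly E n (δ + 1) + ∑ s ∈ Finset.Ico (E 0) (E 0 + c), polyBinom (δ - s) δ := by
        unfold lexPoly
        rw [Finset.sum_range_succ']
        congr 1
        · refine Finset.sum_congr rfl fun i _ => Finset.sum_congr rfl fun s _ => ?_
          push_cast
          rw [show (i : ℤ) + 1 + δ = i + (δ + 1) by ring]
        · simp
      rw [hL, Finset.sum_range_succ']
      have h3 : ∑ i ∈ Finset.range n, ∑ s ∈ Finset.range D, (a (i + 1) s : ℚ[X]) *
          polyBinom (((i + 1 : ℕ) : ℤ) + δ - s) (((i + 1 : ℕ) : ℤ) + δ) =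
          ∑ i ∈ Finset.range n, ∑ s ∈ Finset.range D, (a (i + 1) s : ℚ[X]) *
          polyBinom (i + (δ + 1) - s) (i + (δ + 1)) := by
        refine Finset.sum_congr rfl fun i _ => Finset.sum_congr rfl fun s _ => ?_
        push_cast
        rw [show (i : ℤ) + 1 + δ = i + (δ + 1) by ring]
      rw [h3, h1]
      have h4 : ∑ s ∈ Finset.range D, (a 0 s : ℚ[X]) * polyBinom (δ - s) δ =
          ∑ s ∈ Finset.range (E 0 + c), (a 0 s : ℚ[X]) * polyBinom (δ - s) δ := by
        rcases le_total D (E 0 + c) with h | h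
        · refine Finset.sum_subset (Finset.range_subset_range.2 h) fun s _ hs => ?_
          rw [haD 0 s (by simpa using hs), Nat.cast_zero, zero_mul]
        · refine (Finset.sum_subset (Finset.range_subset_range.2 h) fun s _ hs => ?_).symm
          rw [ha0 s (by simpa using hs), Nat.cast_zero, zero_mul]
      have h5 : ∑ s ∈ Finset.range (E 0), (w s : ℚ[X]) * polyBinom (δ - s) δ =
          ∑ s ∈ Finset.range (E 0 + c),
            ((if s < E 0 then w s else 0 : ℕ) : ℚ[X]) * polyBinom (δ - s) δ := by
        simp only [Nat.cast_ite, Nat.cast_zero, ite_mul, zero_mul]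
        rw [← Finset.sum_filter]
        refine Finset.sum_congr ?_ fun _ _ => rfl
        ext s
        simp only [Finset.mem_filter, Finset.mem_range]
        lia
      have h6 : ∀ s : ℕ, polyBinom (δ - s) δ - polyBinom (δ - ((s + 1 : ℕ) : ℤ)) δ =
          polyBinom (δ - 1 - s) (δ - 1) := by
        intro s
        rw [← polyBinom_sub]
        push_cast
        congr 2 <;> ring
      simp only [h6] at h2
      simp only [add_sub_cancel_right, Nat.cast_zero, zero_add]
      rw [add_assoc, add_assoc]
      refine Eq.trans ?_ (congrArg (lexPoly E n (δ + 1) + ·) h2)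
      rw [h4, h5, ← Finset.sum_add_distrib]
      congr 1
      refine Finset.sum_congr rfl fun s _ => ?_
      simp only [hvdef]
      push_cast
      ring
    · intro hz
      have h1 := hw'z hz
      have h2 : ∀ s < E 0, w s = 0 := by
        intro s hs
        have := h1 s (by lia)
        simp only [hvdef] at this
        rw [if_pos hs, if_neg (by lia)] at this
        lia
      intro i s
      cases i with
      | succ i => exact heq h2 i s
      | zero =>
        by_cases hs : s < E 0 + c
        · have := h1 s hs
          simp only [hvdef] at this
          have h3 : (if s < E 0 then w s else 0) = 0 := by
            split_ifs with h
            · exact h2 s h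
            · rfl
          rw [h3, add_zero] at this
          simp [this, hs]
        · rw [ha0 s (by lia), if_neg (by simp; lia)]

end Rearrangement

section Cells

open Finsupp

/-- The exponent set of a nonzero strongly stable monomial ideal whose generators involve only
the variables of index less than `n`. -/
structure IsStronglyStable (M : Set (ℕ →₀ ℕ)) (n : ℕ) : Prop where
  nonempty : M.Nonempty
  upper : IsUpperSet M
  borel : ∀ w ∈ M, ∀ j, w j ≠ 0 → ∀ i < j, w - single j 1 + single i 1 ∈ M
  filter_mem : ∀ w ∈ M, w.filter (· < n) ∈ M

/-- The exponents that enter `M` after multiplication by variables of index at least `t`. -/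
def tailSaturation (M : Set (ℕ →₀ ℕ)) (t : ℕ) : Set (ℕ →₀ ℕ) :=
  {w | ∃ v : ℕ →₀ ℕ, (∀ i < t, v i = 0) ∧ w + v ∈ M}

/-- `u` is the corner of a cell `u + ⟨e_{t+1}, e_{t+2}, …⟩` of the Stanley decomposition of the
complement of `M`. -/
def IsCell (M : Set (ℕ →₀ ℕ)) (t : ℕ) (u : ℕ →₀ ℕ) : Prop :=
  u ∈ tailSaturation M t ∧ u ∉ tailSaturation M (t + 1) ∧ ∀ j, t < j → u j = 0

variable {M : Set (ℕ →₀ ℕ)} {n : ℕ}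

theorem add_mem_of_borel (hup : IsUpperSet M)
    (hb : ∀ w ∈ M, ∀ j, w j ≠ 0 → ∀ i < j, w - single j 1 + single i 1 ∈ M) {t : ℕ}
    {g h h' : ℕ →₀ ℕ} (hh : ∀ i < t, h i = 0) (hh' : ∀ i, t < i → h' i = 0)
    (hd : h.degree ≤ h'.degree) (hg : g + h ∈ M) : g + h' ∈ M := by
  induction hm : h.degree generalizing g h h' with
  | zero =>
    rw [degree_eq_zero_iff] at hm
    subst hm
    exact hup (by simp) hg
  | succ m ih =>
    obtain ⟨j, hj⟩ : ∃ j, h j ≠ 0 := by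
      by_contra! hc
      rw [(Finsupp.ext hc : h = 0)] at hm
      simp at hm
    obtain ⟨i, hi⟩ : ∃ i, h' i ≠ 0 := by
      by_contra! hc
      rw [(Finsupp.ext hc : h' = 0), hm] at hd
      simp at hd
    have hjt : t ≤ j := not_lt.1 fun hc => hj (hh j hc)
    have hit : i ≤ t := not_lt.1 fun hc => hi (hh' i hc)
    have hj1 : single j 1 ≤ h := by
      rw [single_le_iff]
      lia
    have hi1 : single i 1 ≤ h' := by
      rw [single_le_iff]
      lia
    obtain ⟨k, rfl⟩ := exists_add_of_le hj1
    obtain ⟨k', rfl⟩ := exists_add_of_le hi1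
    rw [map_add, degree_single] at hm
    rw [map_add, map_add, degree_single, degree_single] at hd
    rw [← add_assoc]
    refine ih (h := k) (fun i hi => ?_) (fun i hi => ?_) (by lia) ?_ (by lia)
    · have := hh i hi
      simp only [Finsupp.add_apply] at this
      lia
    · have := hh' i hi
      simp only [Finsupp.add_apply] at this
      lia
    · rcases (hit.trans hjt).eq_or_lt with rfl | hij
      · rwa [add_assoc]
      · have := hb _ hg j (by simp) i hij
        rwa [show g + (single j 1 + k) = g + k + single j 1 by abel, add_tsub_cancel_right,
          show g + k + single i 1 = g + single i 1 + k by abel] at this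

theorem tailSaturation_antitone : Antitone (tailSaturation M) := by
  rintro s t hst w ⟨v, hv, hw⟩
  exact ⟨v, fun i hi => hv i (hi.trans_le hst), hw⟩

theorem subset_tailSaturation (t : ℕ) : M ⊆ tailSaturation M t :=
  fun w hw => ⟨0, fun _ _ => rfl, by simpa using hw⟩

theorem exists_level {s : ℕ} {w : ℕ →₀ ℕ} (hs : w ∈ tailSaturation M s) {r : ℕ} (hsr : s ≤ r)
    (hr : w ∉ tailSaturation M r) :
    ∃ t, s ≤ t ∧ t < r ∧ w ∈ tailSaturation M t ∧ w ∉ tailSaturation M (t + 1) := by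
  induction r, hsr using Nat.le_induction with
  | base => exact absurd hs hr
  | succ r hsr ih =>
    by_cases h : w ∈ tailSaturation M r
    · exact ⟨r, hsr, Nat.lt_succ_self r, h, hr⟩
    · obtain ⟨t, h1, h2, h3⟩ := ih h
      exact ⟨t, h1, h2.trans (Nat.lt_succ_self r), h3⟩

namespace IsStronglyStable

variable (hM : IsStronglyStable M n)
include hM

theorem mem_tailSaturation_of_le {t : ℕ} {w w' : ℕ →₀ ℕ} (h : ∀ i < t, w i ≤ w' i)
    (hw : w ∈ tailSaturation M t) : w' ∈ tailSaturation M t := by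
  obtain ⟨v, hv, hw⟩ := hw
  refine ⟨v + w.filter (t ≤ ·), fun i hi => ?_, hM.upper (fun i => ?_) hw⟩
  · rw [Finsupp.add_apply, hv i hi, filter_apply_neg _ _ (by lia), add_zero]
  · rcases lt_or_ge i t with hi | hi
    · have := h i hi
      simp only [Finsupp.add_apply]
      lia
    · simp only [Finsupp.add_apply, filter_apply_pos _ _ hi]
      lia

theorem mem_tailSaturation_congr {t : ℕ} {w w' : ℕ →₀ ℕ} (h : ∀ i < t, w i = w' i) :
    w ∈ tailSaturation M t ↔ w' ∈ tailSaturation M t :=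
  ⟨hM.mem_tailSaturation_of_le fun i hi => (h i hi).le,
    hM.mem_tailSaturation_of_le fun i hi => (h i hi).ge⟩

theorem mem_of_mem_tailSaturation {t : ℕ} (ht : n ≤ t) {w : ℕ →₀ ℕ}
    (hw : w ∈ tailSaturation M t) : w ∈ M := by
  obtain ⟨v, hv, hw⟩ := hw
  refine hM.upper (fun i => ?_) (hM.filter_mem _ hw)
  rw [filter_apply]
  split_ifs with h
  · rw [Finsupp.add_apply, hv i (by lia), add_zero]
  · exact Nat.zero_le _

theorem isCell_lt {t : ℕ} {u : ℕ →₀ ℕ} (hu : IsCell M t u) : t < n := by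
  by_contra h
  exact hu.2.1 (subset_tailSaturation _ (hM.mem_of_mem_tailSaturation (not_lt.1 h) hu.1))

theorem mem_tailSaturation_zero (w : ℕ →₀ ℕ) : w ∈ tailSaturation M 0 := by
  obtain ⟨v, hv⟩ := hM.nonempty
  exact ⟨v, fun i hi => absurd hi (by lia), hM.upper (by simp) hv⟩

/-- Corners are characterised by their cells. -/
theorem isCell_filter_iff {t : ℕ} {w : ℕ →₀ ℕ} : IsCell M t (w.filter (· ≤ t)) ↔
    w ∈ tailSaturation M t ∧ w ∉ tailSaturation M (t + 1) := by
  unfold IsCell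
  rw [hM.mem_tailSaturation_congr (w := w.filter (· ≤ t)) (w' := w) (t := t)
      fun i hi => filter_apply_pos _ _ hi.le,
    hM.mem_tailSaturation_congr (w := w.filter (· ≤ t)) (w' := w) (t := t + 1)
      fun i hi => filter_apply_pos _ _ (Nat.le_of_lt_succ hi)]
  refine ⟨fun h => ⟨h.1, h.2.1⟩, fun h => ⟨h.1, h.2, fun j hj => filter_apply_neg _ _ (by lia)⟩⟩

theorem notMem_iff {w : ℕ →₀ ℕ} : w ∉ M ↔ ∃ t < n, IsCell M t (w.filter (· ≤ t)) := by
  constructor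
  · intro hw
    obtain ⟨t, -, h2, h3⟩ := exists_level (hM.mem_tailSaturation_zero w) (Nat.zero_le n)
      fun h => hw (hM.mem_of_mem_tailSaturation le_rfl h)
    exact ⟨t, h2, hM.isCell_filter_iff.2 h3⟩
  · rintro ⟨t, -, h⟩ hw
    exact (hM.isCell_filter_iff.1 h).2 (subset_tailSaturation _ hw)

theorem isCell_level_unique {t t' : ℕ} {w : ℕ →₀ ℕ} (h : IsCell M t (w.filter (· ≤ t)))
    (h' : IsCell M t' (w.filter (· ≤ t'))) : t = t' := by
  rw [hM.isCell_filter_iff] at h h'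
  rcases lt_trichotomy t t' with hlt | heq | hlt
  · exact absurd (tailSaturation_antitone hlt h'.1) h.2
  · exact heq
  · exact absurd (tailSaturation_antitone hlt h.1) h'.2

/-- The degree of a corner is bounded by the degrees of generators. -/
theorem isCell_degree_lt {D : ℕ} (hD : ∀ w ∈ M, ∃ g ∈ M, g ≤ w ∧ g.degree ≤ D) {t : ℕ}
    {u : ℕ →₀ ℕ} (hu : IsCell M t u) : u.degree < D := by
  by_contra! hc
  obtain ⟨⟨v, hv, huv⟩, hu1, hu2⟩ := hu
  obtain ⟨g, hg, hgu, hgD⟩ := hD _ huv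
  refine hu1 (subset_tailSaturation _ ?_)
  have hle : g.filter (· < t) ≤ u := fun i => by
    rw [filter_apply]
    split_ifs with h
    · have := hgu i
      rwa [Finsupp.add_apply, hv i h, add_zero] at this
    · exact Nat.zero_le _
  obtain ⟨h', rfl⟩ := exists_add_of_le hle
  have hsplit : g.filter (· < t) + g.filter (t ≤ ·) = g := by
    ext i
    simp only [Finsupp.add_apply, filter_apply]
    split_ifs <;> lia
  have hdeg := congrArg degree hsplit
  rw [map_add] at hdeg hc
  refine add_mem_of_borel hM.upper hM.borel (t := t) (h := g.filter (t ≤ ·)) ?_ ?_ (by lia)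
    (hsplit.symm ▸ hg)
  · intro i hi
    exact filter_apply_neg _ _ (by lia)
  · intro i hi
    have := hu2 i hi
    rw [Finsupp.add_apply] at this
    lia

/-- Dividing a corner by its last variable yields a corner. -/
theorem exists_isCell_pred {t : ℕ} {u : ℕ →₀ ℕ} (hu : IsCell M t u) (h0 : u ≠ 0) :
    ∃ t' ≤ t, ∃ u' p, IsCell M t' u' ∧ p ≤ t' ∧ u = u' + single p 1 := by
  obtain ⟨⟨v, hv, huv⟩, hu1, hu2⟩ := hu
  have hne : u.support.Nonempty := support_nonempty_iff.2 h0
  set p := u.support.max' hne with hp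
  have hup : u p ≠ 0 := mem_support_iff.1 (u.support.max'_mem hne)
  have hmax : ∀ j, p < j → u j = 0 := fun j hj => by
    by_contra hc
    exact absurd (u.support.le_max' j (mem_support_iff.2 hc)) (not_le.2 hj)
  have hpt : p ≤ t := not_lt.1 fun hc => hup (hu2 p hc)
  have h1 : single p 1 ≤ u := by
    rw [single_le_iff]
    lia
  obtain ⟨u', hu'⟩ := exists_add_of_le h1
  rw [add_comm] at hu'
  have hs : u' ∈ tailSaturation M p := by
    refine ⟨single p 1 + v, fun i hi => ?_, by rwa [← add_assoc, ← hu']⟩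
    rw [Finsupp.add_apply, hv i (by lia), single_eq_of_ne (by lia)]
  obtain ⟨t', ht1, ht2, h3, h4⟩ := exists_level hs (show p ≤ t + 1 by lia) fun h =>
    hu1 (hM.mem_tailSaturation_of_le (fun i _ => by rw [hu', Finsupp.add_apply]; lia) h)
  refine ⟨t', by lia, u', p, ⟨h3, h4, fun j hj => ?_⟩, ht1, hu'⟩
  have := hmax j (by lia)
  rw [hu', Finsupp.add_apply] at this
  lia

end IsStronglyStable

open scoped Classical in
/-- The corners of level `t` and degree `s`. -/
noncomputable def cells (M : Set (ℕ →₀ ℕ)) (n t s : ℕ) : Finset (ℕ →₀ ℕ) :=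
  {u ∈ Finset.finsuppAntidiag (Finset.range n) s | IsCell M t u}

open scoped Classical in
/-- The Hilbert function of the complement of `M` in the first `N` variables. -/
noncomputable def complCount (M : Set (ℕ →₀ ℕ)) (N m : ℕ) : ℕ :=
  Finset.card {w ∈ Finset.finsuppAntidiag (Finset.range N) m | w ∉ M}

theorem mem_finsuppAntidiag_iff_degree {s : Finset ℕ} {m : ℕ} {w : ℕ →₀ ℕ} :
    w ∈ Finset.finsuppAntidiag s m ↔ w.degree = m ∧ ∀ i ∉ s, w i = 0 := by
  rw [Finset.mem_finsuppAntidiag]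
  have hsub : w.support ⊆ s ↔ ∀ i ∉ s, w i = 0 := by
    rw [Finset.subset_iff]
    refine forall_congr' fun i => ?_
    rw [mem_support_iff]
    tauto
  rw [hsub]
  refine and_congr_left fun h => ?_
  rw [degree_apply, ← Finset.sum_subset (hsub.2 h)]
  intro i _ hi
  simpa using hi

namespace IsStronglyStable

variable (hM : IsStronglyStable M n)
include hM

theorem mem_cells {t s : ℕ} {u : ℕ →₀ ℕ} : u ∈ cells M n t s ↔ IsCell M t u ∧ u.degree = s := by
  classical
  rw [cells, Finset.mem_filter, mem_finsuppAntidiag_iff_degree]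
  refine ⟨fun h => ⟨h.2, h.1.1⟩, fun h => ⟨⟨h.2, fun i hi => h.1.2.2 i ?_⟩, h.1⟩⟩
  have := hM.isCell_lt h.1
  rw [Finset.mem_range] at hi
  lia

theorem complCount_eq {D : ℕ} (hD : ∀ w ∈ M, ∃ g ∈ M, g ≤ w ∧ g.degree ≤ D) (δ : ℕ) {m : ℕ}
    (hm : D ≤ m) : complCount M (n + 1 + δ) m = ∑ t ∈ Finset.range n, ∑ s ∈ Finset.range D,
      (cells M n t s).card * (m - s + (n - 1 - t + δ)).choose (n - 1 - t + δ) := by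
  classical
  set I : Finset (Σ _ : ℕ × ℕ, ℕ →₀ ℕ) :=
    (Finset.range n ×ˢ Finset.range D).sigma fun p => cells M n p.1 p.2 with hI
  set F : (Σ _ : ℕ × ℕ, ℕ →₀ ℕ) → Finset (ℕ →₀ ℕ) := fun x =>
    (Finset.finsuppAntidiag (Finset.Ico (x.1.1 + 1) (n + 1 + δ)) (m - x.1.2)).image (x.2 + ·)
    with hF
  have hmemI : ∀ x, x ∈ I ↔ IsCell M x.1.1 x.2 ∧ x.2.degree = x.1.2 := by
    intro x
    rw [hI, Finset.mem_sigma, hM.mem_cells, Finset.mem_product, Finset.mem_range, Finset.mem_range]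
    refine ⟨fun h => h.2, fun h => ⟨⟨hM.isCell_lt h.1, ?_⟩, h⟩⟩
    rw [← h.2]
    exact hM.isCell_degree_lt hD h.1
  have hmemF : ∀ x ∈ I, ∀ w, w ∈ F x ↔
      w.degree = m ∧ (∀ i, n + 1 + δ ≤ i → w i = 0) ∧ w.filter (· ≤ x.1.1) = x.2 := by
    rintro ⟨⟨t, s⟩, u⟩ hx w
    obtain ⟨hx, hdeg⟩ := (hmemI _).1 hx
    have hsD := hM.isCell_degree_lt hD hx
    have htn := hM.isCell_lt hx
    simp only at hx hdeg hsD htn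
    simp only [hF, Finset.mem_image, mem_finsuppAntidiag_iff_degree, Finset.mem_Ico, not_and,
      not_lt]
    constructor
    · rintro ⟨v, ⟨hv1, hv2⟩, rfl⟩
      refine ⟨by rw [map_add]; lia, fun i hi => ?_, ?_⟩
      · rw [Finsupp.add_apply, hx.2.2 i (by lia), hv2 i (by lia)]
      · ext i
        rw [filter_apply]
        split_ifs with h
        · rw [Finsupp.add_apply, hv2 i (by lia), add_zero]
        · exact (hx.2.2 i (by lia)).symm
    · rintro ⟨h1, h2, h3⟩
      have hsplit : u + w.filter (t < ·) = w := by
        rw [← h3]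
        ext i
        simp only [Finsupp.add_apply, filter_apply]
        split_ifs <;> lia
      refine ⟨w.filter (t < ·), ⟨?_, fun i hi => ?_⟩, hsplit⟩
      · have := congrArg degree hsplit
        rw [map_add] at this
        lia
      · rw [filter_apply]
        split_ifs with h
        · exact h2 i (hi (by lia))
        · rfl
  have hunion : ({w ∈ Finset.finsuppAntidiag (Finset.range (n + 1 + δ)) m | w ∉ M}
      : Finset (ℕ →₀ ℕ)) = I.biUnion F := by
    ext w
    rw [Finset.mem_filter, mem_finsuppAntidiag_iff_degree, Finset.mem_biUnion]
    simp only [Finset.mem_range, not_lt]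
    constructor
    · rintro ⟨⟨h1, h2⟩, h3⟩
      obtain ⟨t, ht, hc⟩ := hM.notMem_iff.1 h3
      have hx : (⟨(t, (w.filter (· ≤ t)).degree), w.filter (· ≤ t)⟩ : Σ _ : ℕ × ℕ, ℕ →₀ ℕ) ∈ I :=
        (hmemI _).2 ⟨hc, rfl⟩
      exact ⟨_, hx, (hmemF _ hx _).2 ⟨h1, h2, rfl⟩⟩
    · rintro ⟨x, hx, hw⟩
      obtain ⟨h1, h2, h3⟩ := (hmemF _ hx _).1 hw
      have hc := ((hmemI _).1 hx).1
      exact ⟨⟨h1, h2⟩, hM.notMem_iff.2 ⟨x.1.1, hM.isCell_lt hc, h3 ▸ hc⟩⟩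
  rw [complCount, hunion, Finset.card_biUnion]
  · rw [hI, Finset.sum_sigma, Finset.sum_product]
    refine Finset.sum_congr rfl fun t ht => Finset.sum_congr rfl fun s _ => ?_
    rw [Finset.mem_range] at ht
    rw [Finset.sum_const_nat (m := (m - s + (n - 1 - t + δ)).choose (n - 1 - t + δ))]
    intro u _
    rw [hF, Finset.card_image_of_injective _ (add_right_injective _),
      Finset.card_finsuppAntidiag_nat_eq_choose, Nat.card_Ico]
    rw [← Nat.choose_symm_of_eq_add (show n + 1 + δ - (t + 1) + (m - s) - 1 =
      (n - 1 - t + δ) + (m - s) by lia)]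
    congr 1
    lia
  · intro x hx y hy hxy
    refine Finset.disjoint_left.2 fun w hwx hwy => ?_
    rw [Finset.mem_coe] at hx hy
    obtain ⟨-, -, h3⟩ := (hmemF _ hx _).1 hwx
    obtain ⟨-, -, h3'⟩ := (hmemF _ hy _).1 hwy
    obtain ⟨hcx, hdx⟩ := (hmemI _).1 hx
    obtain ⟨hcy, hdy⟩ := (hmemI _).1 hy
    obtain ⟨⟨t, s⟩, u⟩ := x
    obtain ⟨⟨t', s'⟩, u'⟩ := y
    simp only at *
    have := hM.isCell_level_unique (h3.symm ▸ hcx) (h3'.symm ▸ hcy)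
    subst this
    exact hxy (by rw [← hdx, ← hdy, ← h3, ← h3'])

end IsStronglyStable

end Cells

section LexShape

open Finsupp

variable {M : Set (ℕ →₀ ℕ)} {n : ℕ}

namespace IsStronglyStable

variable (hM : IsStronglyStable M n)
include hM

/-- The Hilbert polynomials of `M` in `n + 1` and in `n + 2` variables. -/
theorem exists_complCount_eq_eval {D : ℕ} (hD : ∀ w ∈ M, ∃ g ∈ M, g ≤ w ∧ g.degree ≤ D) :
    ∃ E w : ℕ → ℕ, Antitone E ∧ (∀ i, n ≤ i → E i = 0) ∧
      (∀ m : ℕ, D ≤ m → (complCount M (n + 1) m : ℚ) = (lexPoly E n 0).eval (m : ℚ)) ∧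
      (∀ m : ℕ, D ≤ m → (complCount M (n + 2) m : ℚ) =
        (Polynomial.C ((∑ s ∈ Finset.range (E 0), w s : ℕ) : ℚ) +
          lexPoly E n 1).eval (m : ℚ)) ∧
      ((∀ s < E 0, w s = 0) → ∀ t < n, ∀ s, (cells M n t s).card =
        if E (n - t) ≤ s ∧ s < E (n - (t + 1)) then 1 else 0) := by
  set a : ℕ → ℕ → ℕ := fun i s => if i < n then (cells M n (n - 1 - i) s).card else 0 with ha
  have ha' : ∀ i s, a i s ≠ 0 ↔ i < n ∧ ∃ u, IsCell M (n - 1 - i) u ∧ u.degree = s := by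
    intro i s
    simp only [ha]
    split_ifs with h
    · rw [Finset.card_ne_zero]
      simp only [h, true_and, Finset.Nonempty, hM.mem_cells]
    · simp [h]
  have heval : ∀ δ m : ℕ, D ≤ m → (complCount M (n + 1 + δ) m : ℚ) =
      (∑ i ∈ Finset.range n, ∑ s ∈ Finset.range D,
        (a i s : Polynomial ℚ) * polyBinom (i + (δ : ℤ) - s) (i + δ)).eval (m : ℚ) := by
    intro δ m hm
    rw [hM.complCount_eq hD δ hm, ← Finset.sum_range_reflect, Polynomial.eval_finsetSum]
    push_cast
    refine Finset.sum_congr rfl fun i hi => ?_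
    rw [Finset.mem_range] at hi
    rw [Polynomial.eval_finsetSum]
    refine Finset.sum_congr rfl fun s hs => ?_
    rw [Finset.mem_range] at hs
    rw [Polynomial.eval_mul, Polynomial.eval_natCast,
      show (i : ℤ) + δ = ((i + δ : ℕ) : ℤ) by push_cast; rfl, polyBinom_eval _ _ _ (by lia),
      show n - 1 - (n - 1 - i) + δ = i + δ by lia]
    simp only [ha, hi, if_true]
  obtain ⟨E, w, hE, hEn, -, hsum, hw⟩ := exists_lexPoly_add D n a
    (fun i hi s => by simp [ha, not_lt.2 hi])
    (fun i s hs => by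
      by_contra h
      obtain ⟨-, u, hu, rfl⟩ := (ha' i s).1 h
      exact absurd (hM.isCell_degree_lt hD hu) (not_lt.2 hs))
    (fun i s h => by
      obtain ⟨hi, u, hu, hus⟩ := (ha' i _).1 h
      obtain ⟨t', ht', u', p, hu', -, rfl⟩ := hM.exists_isCell_pred hu (by rintro rfl; simp at hus)
      refine ⟨n - 1 - t', by lia, (ha' _ _).2 ⟨by lia, u', ?_, ?_⟩⟩
      · rwa [show n - 1 - (n - 1 - t') = t' by lia]
      · rw [map_add, degree_single] at hus
        lia)
  refine ⟨E, w, hE, hEn, fun m hm => ?_, fun m hm => ?_, fun h t ht s => ?_⟩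
  · rw [← add_zero (n + 1), heval 0 m hm, Nat.cast_zero, hsum 0]
    simp [polyBinom_of_neg]
  · rw [show n + 2 = n + 1 + 1 from rfl, heval 1 m hm, Nat.cast_one, hsum 1, add_comm]
    simp [polyBinom_zero]
  · have := hw h (n - 1 - t) s
    simp only [ha, show n - 1 - t < n by lia, if_true] at this
    rwa [show n - 1 - (n - 1 - t) = t by lia, show n - 1 - t + 1 = n - t by lia,
      show n - 1 - t = n - (t + 1) by lia] at this

variable {S : ℕ → ℕ} (hS : Monotone S) (hcard : ∀ t < n, ∀ s, (cells M n t s).card =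
  if S t ≤ s ∧ s < S (t + 1) then 1 else 0)
include hS hcard

omit hS in
theorem le_degree_of_isCell {t : ℕ} {u : ℕ →₀ ℕ} (hu : IsCell M t u) :
    S t ≤ u.degree ∧ u.degree < S (t + 1) := by
  by_contra h
  have := hcard t (hM.isCell_lt hu) u.degree
  rw [if_neg h, Finset.card_eq_zero] at this
  exact Finset.notMem_empty u (this ▸ hM.mem_cells.2 ⟨hu, rfl⟩)

theorem isCell_unique {t t' : ℕ} {u u' : ℕ →₀ ℕ} (hu : IsCell M t u) (hu' : IsCell M t' u')
    (h : u.degree = u'.degree) : u = u' := by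
  have h1 := hM.le_degree_of_isCell hcard hu
  have h2 := hM.le_degree_of_isCell hcard hu'
  rcases lt_trichotomy t t' with hlt | rfl | hlt
  · have := hS (Nat.succ_le_of_lt hlt)
    simp only [Nat.succ_eq_add_one] at this
    lia
  · have := hcard t (hM.isCell_lt hu) u.degree
    rw [if_pos h1, Finset.card_eq_one] at this
    obtain ⟨v, hv⟩ := this
    have e1 := hM.mem_cells.2 ⟨hu, rfl⟩
    have e2 := hM.mem_cells.2 ⟨hu', h.symm⟩
    rw [hv, Finset.mem_singleton] at e1 e2
    rw [e1, e2]
  · have := hS (Nat.succ_le_of_lt hlt)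
    simp only [Nat.succ_eq_add_one] at this
    lia

theorem isCell_apply {t : ℕ} {u : ℕ →₀ ℕ} (hu : IsCell M t u) (j : ℕ) :
    u j = min (S (j + 1)) u.degree - min (S j) u.degree := by
  induction hs : u.degree generalizing t u with
  | zero =>
    rw [degree_eq_zero_iff] at hs
    simp [hs]
  | succ s ih =>
    obtain ⟨t', -, u', p, hu', hpt, rfl⟩ := hM.exists_isCell_pred hu (by rintro rfl; simp at hs)
    have hdeg : u'.degree = s := by
      rw [map_add, degree_single] at hs
      lia
    have hyM : u' + single t' 1 ∉ M := fun hy => by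
      refine hu.2.1 (subset_tailSaturation _ ?_)
      rcases hpt.eq_or_lt with rfl | hlt
      · exact hy
      · simpa using hM.borel _ hy t' (by simp) p hlt
    have hysat : u' + single t' 1 ∈ tailSaturation M t' :=
      hM.mem_tailSaturation_of_le (fun i _ => by simp) hu'.1
    obtain ⟨t'', h1, -, h3, h4⟩ := exists_level hysat (hM.isCell_lt hu').le
      fun h => hyM (hM.mem_of_mem_tailSaturation le_rfl h)
    have hy : IsCell M t'' (u' + single t' 1) := ⟨h3, h4, fun i hi => by
      rw [Finsupp.add_apply, hu'.2.2 i (by lia), single_eq_of_ne (by lia), add_zero]⟩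
    have heq := hM.isCell_unique hS hcard hu hy (by simp)
    rw [heq, Finsupp.add_apply, ih hu' hdeg]
    have hb := hM.le_degree_of_isCell hcard hu'
    rw [hdeg] at hb
    rcases lt_trichotomy j t' with hlt | rfl | hlt
    · have e1 := hS (Nat.succ_le_of_lt hlt)
      have e2 := hS hlt.le
      simp only [Nat.succ_eq_add_one] at e1
      rw [single_eq_of_ne (by lia)]
      lia
    · rw [single_eq_same]
      lia
    · have e1 := hS (Nat.succ_le_of_lt hlt)
      have e2 := hS (Nat.le_add_right j 1)
      simp only [Nat.succ_eq_add_one] at e1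
      rw [single_eq_of_ne (by lia)]
      lia

theorem notMem_iff_of_card_cells {w : ℕ →₀ ℕ} : w ∉ M ↔
    ∃ t < n, (∀ j < t, w j + S j = S (j + 1)) ∧ w t + S t < S (t + 1) := by
  rw [hM.notMem_iff]
  refine exists_congr fun t => and_congr_right fun ht => ⟨fun hu => ?_, fun ⟨hw, hwt⟩ => ?_⟩
  · have hb := hM.le_degree_of_isCell hcard hu
    have happ := hM.isCell_apply hS hcard hu
    refine ⟨fun j hj => ?_, ?_⟩
    · have h := happ j
      have e1 := hS (Nat.succ_le_of_lt hj)
      have e2 := hS (Nat.le_add_right j 1)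
      simp only [Nat.succ_eq_add_one] at e1
      rw [filter_apply_pos (· ≤ t) w hj.le] at h
      lia
    · have h := happ t
      rw [filter_apply_pos (· ≤ t) w le_rfl] at h
      lia
  · have h1 : (cells M n t (w t + S t)).card = 1 := by
      rw [hcard t ht, if_pos ⟨by lia, hwt⟩]
    obtain ⟨u, hu⟩ := Finset.card_pos.1 (h1 ▸ Nat.one_pos)
    obtain ⟨hu, hdeg⟩ := hM.mem_cells.1 hu
    convert hu using 1
    have happ := hM.isCell_apply hS hcard hu
    rw [hdeg] at happ
    ext j
    rw [filter_apply]
    split_ifs with hj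
    · rcases hj.eq_or_lt with rfl | hj
      · rw [happ]
        lia
      · have e1 := hS (Nat.succ_le_of_lt hj)
        have e2 := hS (Nat.le_add_right j 1)
        have e3 := hw j hj
        simp only [Nat.succ_eq_add_one] at e1
        rw [happ]
        lia
    · exact (hu.2.2 j (by lia)).symm

omit hS hcard in
/-- If the corners are distributed as for a lexicographic ideal, then `M` is lexicographic. -/
theorem mem_iff_lexExp_le (hn : 1 ≤ n) {E : ℕ → ℕ} (hE : Antitone E)
    (hcard : ∀ t < n, ∀ s, (cells M n t s).card =
      if E (n - t) ≤ s ∧ s < E (n - (t + 1)) then 1 else 0) {a : ℕ → ℕ}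
    (ha : ∀ i, a i = E i - E (i + 1)) {w : ℕ →₀ ℕ} :
    w ∈ M ↔ ∃ m < n, ∀ j : Fin (n + 1), lexExp n a m j ≤ w j := by
  have hA : ∀ j < n, a (n - 1 - j) + E (n - j) = E (n - (j + 1)) := fun j hj => by
    have := hE (show n - (j + 1) ≤ n - j by lia)
    rw [ha, show n - 1 - j + 1 = n - j by lia, show n - 1 - j = n - (j + 1) by lia]
    lia
  have hS : Monotone fun j => E (n - j) := fun i j hij => hE (by lia)
  rw [← not_iff_not, hM.notMem_iff_of_card_cells hS hcard]
  simp only [lexExp, equivFunOnFinite_symm_apply_apply]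
  constructor
  · rintro ⟨t, ht, h1, h2⟩ ⟨m, hm, hle⟩
    have hAt := hA t ht
    rcases lt_trichotomy t m with hlt | rfl | hlt
    · have := hle ⟨t, by lia⟩
      simp only [hlt, if_true] at this
      lia
    · have := hle ⟨t, by lia⟩
      simp only [lt_irrefl, if_true, if_false] at this
      split_ifs at this with h
      · rw [show n - 1 - t = 0 by lia] at hAt
        lia
      · lia
    · have := hle ⟨m, by lia⟩
      have hAm := hA m hm
      have h1m := h1 m hlt
      simp only [lt_irrefl, if_true, if_false, show m ≠ n - 1 by lia] at this
      lia
  · intro h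
    by_contra! hc
    refine h ?_
    have hle : ∀ m < n, (∀ j < m, w j + E (n - j) = E (n - (j + 1))) → ∀ j ≤ m,
        a (n - 1 - j) ≤ w j := fun m hm hj j hjm => by
      have hAj := hA j (by lia)
      rcases hjm.eq_or_lt with rfl | hlt
      · have := hc j hm hj
        lia
      · have := hj j hlt
        lia
    by_cases hall : ∀ j < n - 1, w j + E (n - j) = E (n - (j + 1))
    · refine ⟨n - 1, by lia, fun j => ?_⟩
      have := hle (n - 1) (by lia) hall j
      rw [if_pos rfl]
      split_ifs with h1 h2
      · exact this h1.le
      · have := this h2.le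
        rwa [show n - 1 - (j : ℕ) = 0 by lia] at this
      · exact Nat.zero_le _
    · push Not at hall
      classical
      obtain ⟨hm1, hm2⟩ := Nat.find_spec hall
      have hmin : ∀ j < Nat.find hall, w j + E (n - j) = E (n - (j + 1)) := fun j hj => by
        by_contra hne
        exact Nat.find_min hall hj ⟨by lia, hne⟩
      set m := Nat.find hall
      refine ⟨m, by lia, fun j => ?_⟩
      have := hle m (by lia) hmin j
      split_ifs with h1 h2 h3
      · exact this h1.le
      · lia
      · have hAm := hA m (by lia)
        have := hc m (by lia) hmin
        rw [h2]
        lia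
      · exact Nat.zero_le _

end IsStronglyStable

end LexShape

section MonomialIdeal

open Finsupp

variable {k : Type*} [Field k] {N : ℕ}

/-- The exponents, on infinitely many variables, of the multiples of the monomials in `S`. -/
def multiples (S : Set (Fin N →₀ ℕ)) : Set (ℕ →₀ ℕ) :=
  {w | ∃ s ∈ S, ∀ j : Fin N, s j ≤ w j}

variable {S : Set (Fin N →₀ ℕ)}

theorem mapDomain_val_apply (u : Fin N →₀ ℕ) (j : Fin N) : u.mapDomain Fin.val (j : ℕ) = u j :=
  mapDomain_apply Fin.val_injective u j

theorem mapDomain_val_eq_zero (u : Fin N →₀ ℕ) {i : ℕ} (hi : N ≤ i) :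
    u.mapDomain Fin.val i = 0 :=
  mapDomain_of_notMem_range _ _ fun ⟨j, hj⟩ => absurd j.2 (by lia)

/-- The restriction of an exponent to the first `N` variables. -/
noncomputable def restrictFin (N : ℕ) (w : ℕ →₀ ℕ) : Fin N →₀ ℕ :=
  w.comapDomain Fin.val Fin.val_injective.injOn

theorem restrictFin_apply (w : ℕ →₀ ℕ) (j : Fin N) : restrictFin N w j = w j :=
  rfl

theorem restrictFin_mapDomain (u : Fin N →₀ ℕ) : restrictFin N (u.mapDomain Fin.val) = u :=
  Finsupp.ext fun j => mapDomain_val_apply u j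

theorem mapDomain_restrictFin {w : ℕ →₀ ℕ} (hw : ∀ i, N ≤ i → w i = 0) :
    (restrictFin N w).mapDomain Fin.val = w := by
  ext i
  rcases lt_or_ge i N with hi | hi
  · exact mapDomain_val_apply (restrictFin N w) ⟨i, hi⟩
  · rw [mapDomain_val_eq_zero _ hi, hw i hi]

theorem mem_multiples_iff {w : ℕ →₀ ℕ} :
    w ∈ multiples S ↔ ∃ s ∈ S, s ≤ restrictFin N w :=
  Iff.rfl

theorem monomial_mem_span_iff {u : Fin N →₀ ℕ} {c : k} (hc : c ≠ 0) :
    MvPolynomial.monomial u c ∈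
      Ideal.span ((fun u => MvPolynomial.monomial u (1 : k)) '' S) ↔ ∃ s ∈ S, s ≤ u := by
  classical
  rw [MvPolynomial.mem_ideal_span_monomial_image, MvPolynomial.support_monomial, if_neg hc]
  simp

theorem isUpperSet_multiples : IsUpperSet (multiples S) := by
  rintro w w' hww' ⟨s, hs, hsw⟩
  exact ⟨s, hs, fun j => (hsw j).trans (hww' j)⟩

/-- Dickson's lemma: a monomial ideal is generated in bounded degree. -/
theorem exists_degree_bound_multiples (S : Set (Fin N →₀ ℕ)) :
    ∃ D, ∀ w ∈ multiples S, ∃ g ∈ multiples S, g ≤ w ∧ g.degree ≤ D := by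
  have hfin : {u | Minimal (· ∈ S) u}.Finite :=
    WellQuasiOrderedLE.finite_of_isAntichain (setOfPred_minimal_antichain _)
  obtain ⟨D, hD⟩ := (hfin.image degree).bddAbove
  refine ⟨D, fun w hw => ?_⟩
  obtain ⟨s, hs, hsw⟩ := mem_multiples_iff.1 hw
  obtain ⟨u, hus, hu⟩ := exists_minimal_le_of_wellFoundedLT (· ∈ S) s hs
  refine ⟨u.mapDomain Fin.val, ⟨u, hu.1, fun j => (mapDomain_val_apply u j).ge⟩, fun i => ?_, ?_⟩
  · rcases lt_or_ge i N with hi | hi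
    · exact (mapDomain_val_apply u ⟨i, hi⟩).trans_le ((hus.trans hsw) ⟨i, hi⟩)
    · rw [mapDomain_val_eq_zero _ hi]
      exact Nat.zero_le _
  · rw [degree_mapDomain]
    exact hD (Set.mem_image_of_mem _ hu)

/-- The Hilbert function of a monomial ideal counts the monomials outside of it. -/
theorem hilbFn_span_monomial (S : Set (Fin N →₀ ℕ)) (i : ℕ) :
    hilbFn (Ideal.span ((fun u => MvPolynomial.monomial u (1 : k)) '' S)) i =
      complCount (multiples S) N i := by
  classical
  set W : Finset (ℕ →₀ ℕ) :=
    {w ∈ Finset.finsuppAntidiag (Finset.range N) i | w ∉ multiples S} with hW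
  have hmem : ∀ w, w ∈ W ↔ (w.degree = i ∧ ∀ j, N ≤ j → w j = 0) ∧ w ∉ multiples S := fun w => by
    rw [hW, Finset.mem_filter, mem_finsuppAntidiag_iff_degree]
    simp
  have hdeg : ∀ w ∈ W, (restrictFin N w).degree = i := fun w hw => by
    have h := ((hmem w).1 hw).1
    rw [← degree_mapDomain Fin.val, mapDomain_restrictFin h.2, h.1]
  let φ : MvPolynomial.homogeneousSubmodule (Fin N) k i →ₗ[k] (W → k) :=
    LinearMap.pi fun w => (MvPolynomial.lcoeff k (restrictFin N w.1)) ∘ₗ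
      (MvPolynomial.homogeneousSubmodule (Fin N) k i).subtype
  have hφ : ∀ p w, φ p w = MvPolynomial.coeff (restrictFin N w.1) p.1 := fun p w => rfl
  have hker : LinearMap.ker φ = Submodule.comap
      (MvPolynomial.homogeneousSubmodule (Fin N) k i).subtype (Submodule.restrictScalars k
        (Ideal.span ((fun u => MvPolynomial.monomial u (1 : k)) '' S))) := by
    ext p
    rw [LinearMap.mem_ker, Submodule.mem_comap, Submodule.restrictScalars_mem,
      Submodule.subtype_apply, MvPolynomial.mem_ideal_span_monomial_image]
    constructor
    · intro hp u hu
      have hudeg : u.degree = i := by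
        have := p.2 (MvPolynomial.mem_support_iff.1 hu)
        rw [degree_eq_weight_one]
        exact this
      by_contra h
      have hw : u.mapDomain Fin.val ∈ W := (hmem _).2
        ⟨⟨by rw [degree_mapDomain, hudeg], fun j hj => mapDomain_val_eq_zero u hj⟩, fun hm => h <| by
          rwa [mem_multiples_iff, restrictFin_mapDomain] at hm⟩
      have := congrFun hp ⟨_, hw⟩
      rw [hφ, restrictFin_mapDomain] at this
      exact MvPolynomial.mem_support_iff.1 hu this
    · intro h
      funext w
      rw [hφ]
      by_contra hc
      exact ((hmem _).1 w.2).2 (mem_multiples_iff.2 (h _ (MvPolynomial.mem_support_iff.2 hc)))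
  have hsurj : Function.Surjective φ := by
    intro g
    refine ⟨⟨∑ w : W, MvPolynomial.monomial (restrictFin N w.1) (g w),
      Submodule.sum_mem _ fun w _ => MvPolynomial.isHomogeneous_monomial _ (hdeg _ w.2)⟩, ?_⟩
    funext w
    rw [hφ, MvPolynomial.coeff_sum]
    simp_rw [MvPolynomial.coeff_monomial]
    rw [Finset.sum_eq_single w _ fun h => absurd (Finset.mem_univ w) h, if_pos rfl]
    intro v _ hv
    refine if_neg fun h => hv (Subtype.ext ?_)
    rw [← mapDomain_restrictFin ((hmem _).1 v.2).1.2, h,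
      mapDomain_restrictFin ((hmem _).1 w.2).1.2]
  rw [hilbFn, ← hker, (LinearMap.quotKerEquivOfSurjective φ hsurj).finrank_eq,
    Module.finrank_fintype_fun_eq_card, Fintype.card_coe, complCount]

theorem map_rename_castSucc_span_monomial (S : Set (Fin N →₀ ℕ)) :
    Ideal.map (MvPolynomial.rename (Fin.castSucc : Fin N → Fin (N + 1)))
      (Ideal.span ((fun u => MvPolynomial.monomial u (1 : k)) '' S)) =
    Ideal.span ((fun u => MvPolynomial.monomial u (1 : k)) '' (mapDomain Fin.castSucc '' S)) := by
  rw [Ideal.map_span, Set.image_image, Set.image_image]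
  simp_rw [MvPolynomial.rename_monomial]

theorem multiples_image_mapDomain_castSucc (S : Set (Fin N →₀ ℕ)) :
    multiples (mapDomain Fin.castSucc '' S : Set (Fin (N + 1) →₀ ℕ)) = multiples S := by
  ext w
  constructor
  · rintro ⟨_, ⟨s, hs, rfl⟩, h⟩
    refine ⟨s, hs, fun j => ?_⟩
    have := h j.castSucc
    rwa [mapDomain_apply (Fin.castSucc_injective N)] at this
  · rintro ⟨s, hs, h⟩
    refine ⟨_, ⟨s, hs, rfl⟩, fun j => ?_⟩
    induction j using Fin.lastCases with
    | last =>
      rw [mapDomain_of_notMem_range _ _ (by simp)]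
      exact Nat.zero_le _
    | cast j =>
      rw [mapDomain_apply (Fin.castSucc_injective N)]
      exact h j

theorem complCount_empty (n m : ℕ) : complCount ∅ (n + 1) m = (n + m).choose n := by
  classical
  simp only [complCount, Set.mem_empty_iff_false, not_false_eq_true, Finset.filter_true]
  rw [Finset.card_finsuppAntidiag_nat_eq_choose, Finset.card_range,
    show n + 1 + m - 1 = n + m by lia, Nat.choose_symm_add]

theorem isStronglyStable_multiples {n : ℕ} {S : Set (Fin (n + 1) →₀ ℕ)} (hS : S.Nonempty)
    (hborel : IsBorel (Ideal.span ((fun u => MvPolynomial.monomial u (1 : k)) '' S)))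
    (hsat : IsSaturatedIdeal (Ideal.span ((fun u => MvPolynomial.monomial u (1 : k)) '' S))) :
    IsStronglyStable (multiples S) n := by
  have hiff : ∀ w, w ∈ multiples S ↔ MvPolynomial.monomial (restrictFin (n + 1) w) (1 : k) ∈
      Ideal.span ((fun u => MvPolynomial.monomial u (1 : k)) '' S) := fun w => by
    rw [monomial_mem_span_iff one_ne_zero, mem_multiples_iff]
  have hb : ∀ w ∈ multiples S, ∀ j, w j ≠ 0 → ∀ i < j,
      w - single j 1 + single i 1 ∈ multiples S := by
    intro w hw j hj i hij
    rcases lt_or_ge j (n + 1) with hjn | hjn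
    · have := hborel _ ((hiff w).1 hw) ⟨j, hjn⟩ hj ⟨i, hij.trans hjn⟩ hij
      rw [hiff]
      convert this using 4
      ext l
      simp [restrictFin_apply, single_apply, Fin.ext_iff]
    · obtain ⟨s, hs, hsw⟩ := hw
      refine ⟨s, hs, fun l => ?_⟩
      rw [Finsupp.add_apply, tsub_apply, single_eq_of_ne (a := j) (by lia)]
      exact (hsw l).trans (by lia)
  refine ⟨?_, isUpperSet_multiples, hb, fun w hw => ?_⟩
  · obtain ⟨s, hs⟩ := hS
    exact ⟨s.mapDomain Fin.val, s, hs, fun j => (mapDomain_val_apply s j).ge⟩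
  · rw [hiff]
    refine hsat _ ⟨w n + 1, Nat.le_add_left 1 _, fun g hg => ?_⟩
    rw [MvPolynomial.pow_idealOfVars_eq_span] at hg
    induction hg using Submodule.span_induction with
    | mem g hg =>
      obtain ⟨y, hy, rfl⟩ := hg
      have hw' : w.filter (· < n) + single n (w n) ∈ multiples S := by
        obtain ⟨s, hs, hsw⟩ := hw
        refine ⟨s, hs, fun j => (hsw j).trans ?_⟩
        rw [Finsupp.add_apply, filter_apply, single_apply]
        split_ifs with h1 h2 h2
        · lia
        · lia
        · rw [← h2, zero_add]
        · lia
      have := add_mem_of_borel isUpperSet_multiples hb (t := n) (h' := y.mapDomain Fin.val)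
        (fun i hi => single_eq_of_ne (by lia)) (fun i hi => mapDomain_val_eq_zero y hi)
        (by rw [degree_single, degree_mapDomain, show y.degree = _ from hy]; lia) hw'
      rw [hiff] at this
      rw [MvPolynomial.monomial_mul, one_mul]
      convert this using 4
      ext l
      rw [restrictFin_apply, Finsupp.add_apply, Finsupp.add_apply, mapDomain_val_apply,
        restrictFin_apply]
    | zero => simp
    | add x y _ _ hx hy =>
      rw [mul_add]
      exact Ideal.add_mem _ hx hy
    | smul a x _ hx =>
      rw [smul_eq_mul, mul_left_comm]
      exact Ideal.mul_mem_left _ _ hx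

end MonomialIdeal

section Assembly

open Polynomial in
theorem eq_of_eval_natCast_eq {p q : ℚ[X]} {N : ℕ}
    (h : ∀ m : ℕ, N ≤ m → p.eval (m : ℚ) = q.eval (m : ℚ)) : p = q := by
  refine Polynomial.eq_of_infinite_eval_eq p q (Set.Infinite.mono ?_
    ((Set.Ici_infinite N).image (Nat.cast_injective (R := ℚ)).injOn))
  rintro _ ⟨m, hm, rfl⟩
  exact h m hm

theorem exists_toNat_eExt {d : ℕ} {e : Fin (d + 1) → ℤ} (he : Antitone e)
    (hepos : ∀ i, 0 < e i) : ∃ E : ℕ → ℕ, Antitone E ∧ (∀ i, (E i : ℤ) = eExt d e i) ∧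
      (∀ i, d < i → E i = 0) ∧ ∀ i, aSeq d e i = E i - E (i + 1) := by
  have hnn : ∀ i, 0 ≤ eExt d e i := fun i => by
    unfold eExt
    split_ifs with h
    · exact (hepos _).le
    · exact le_rfl
  have hcast : ∀ i, ((eExt d e i).toNat : ℤ) = eExt d e i := fun i => Int.toNat_of_nonneg (hnn i)
  refine ⟨fun i => (eExt d e i).toNat, fun i j hij => ?_, hcast, fun i hi => ?_, fun i => ?_⟩
  · refine Int.toNat_le_toNat ?_
    unfold eExt
    split_ifs with h1 h2 h2
    · exact he hij
    · lia
    · exact (hepos _).le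
    · exact le_rfl
  · simp [eExt, not_le.2 hi]
  · have h1 := hcast i
    have h2 := hcast (i + 1)
    simp only [aSeq]
    lia

theorem eq_lexIdealGen {k : Type*} [Field k] {n : ℕ} {S : Set (Fin (n + 1) →₀ ℕ)} {a : ℕ → ℕ}
    (h : ∀ w, w ∈ multiples S ↔ ∃ m < n, ∀ j : Fin (n + 1), lexExp n a m j ≤ w j) :
    Ideal.span ((fun u => MvPolynomial.monomial u (1 : k)) '' S) = lexIdealGen k n a := by
  have himage : (fun m => MvPolynomial.monomial (lexExp n a m) (1 : k)) '' {m | m < n} =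
      (fun u => MvPolynomial.monomial u (1 : k)) '' (lexExp n a '' {m | m < n}) := by
    rw [Set.image_image]
  ext p
  rw [lexIdealGen, himage, MvPolynomial.mem_ideal_span_monomial_image,
    MvPolynomial.mem_ideal_span_monomial_image]
  refine forall₂_congr fun u _ => ?_
  rw [Set.exists_mem_image]
  have := h (u.mapDomain Fin.val)
  rw [mem_multiples_iff, restrictFin_mapDomain] at this
  rw [this]
  simp only [mapDomain_val_apply]
  rfl

end Assembly

/-- If `J ⊆ k[x_0,…,x_n]` is a saturated Borel monomial ideal with Hilbert polynomial `q`
of degree `d < n`, Gotzmann partition `(b_1,…,b_r)` and Macaulay–Hartshorne partition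
`(e_0,…,e_d)`, and `J` is not the lexicographic ideal `L^q_n`, then the Hilbert
polynomial of `k[x_0,…,x_{n+1}]/(J·k[x_0,…,x_{n+1}])` differs from
`Σ_{j=1}^r C(t + (b_j+1) − (j−1), b_j+1)` by a positive integer constant (in particular
it is not equal to it). -/
theorem statement_19 (k : Type*) [Field k] (n : ℕ) (hn : 1 ≤ n)
    (J : Ideal (MvPolynomial (Fin (n + 1)) k))
    (hmon : IsMonomialIdeal J) (hborel : IsBorel J) (hsat : IsSaturatedIdeal J)
    (q : Polynomial ℚ) (d r : ℕ) (hdn : d < n)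
    (e : Fin (d + 1) → ℤ) (he : Antitone e) (hepos : ∀ i, 0 < e i)
    (b : Fin r → ℤ) (hb : Antitone b) (hbnn : ∀ j, 0 ≤ b j)
    (hqe : q = mhSum d e) (hqb : q = gotzmannSum r b)
    (hq : ∃ N : ℕ, ∀ i : ℕ, N ≤ i → (hilbFn J i : ℚ) = q.eval (i : ℚ))
    (hne : J ≠ lexIdealGen k n (aSeq d e)) :
    ∃ m : ℕ, 0 < m ∧
      ∃ N : ℕ, ∀ i : ℕ, N ≤ i →
        (hilbFn (Ideal.map (MvPolynomial.rename (Fin.castSucc : Fin (n + 1) → Fin (n + 2))) J)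
            i : ℚ)
          = (Polynomial.C (m : ℚ) +
              ∑ j : Fin r, polyBinom (b j + 1 - ((j : ℕ) : ℤ)) (b j + 1)).eval (i : ℚ) := by
  obtain ⟨S, rfl⟩ := hmon
  obtain ⟨N, hq⟩ := hq
  simp_rw [hilbFn_span_monomial] at hq
  obtain ⟨E, hE, hEe, hEd, ha⟩ := exists_toNat_eExt he hepos
  have hqE : q = lexPoly E n 0 := hqe.trans (mhSum_eq_lexPoly hdn hE hEe)
  have hS : S.Nonempty := by
    rw [Set.nonempty_iff_ne_empty]
    rintro rfl
    have hempty : multiples (∅ : Set (Fin (n + 1) →₀ ℕ)) = ∅ :=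
      Set.eq_empty_of_forall_notMem fun w ⟨s, hs, _⟩ => hs
    have hqn : polyBinom n n = q := eq_of_eval_natCast_eq (N := N) fun m hm => by
      have := polyBinom_eval 0 n m (Nat.zero_le m)
      rw [Nat.cast_zero, sub_zero, Nat.sub_zero] at this
      rw [this, ← hq m hm, hempty, complCount_empty, add_comm]
    have hcoeff := polyBinom_coeff_self n n
    rw [hqn, hqE, lexPoly_coeff_eq_zero le_rfl] at hcoeff
    exact inv_ne_zero (Nat.cast_ne_zero.2 n.factorial_ne_zero) hcoeff.symm
  have hM := isStronglyStable_multiples hS hborel hsat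
  obtain ⟨D, hD⟩ := exists_degree_bound_multiples S
  obtain ⟨E', w, hE', hEn', hH, hH', hcells⟩ := hM.exists_complCount_eq_eval hD
  have hEE' : E' = E := by
    refine lexPoly_injective hE' hE n (fun i hi => ?_) ?_
    · rw [hEn' i hi, hEd i (by lia)]
    · refine eq_of_eval_natCast_eq (N := max N D) fun m hm => ?_
      rw [← hqE, ← hq m (by lia), hH m (by lia)]
  subst hEE'
  obtain ⟨B, K, hB, hBK, hsum⟩ := exists_lexPoly_of_antitone hb hbnn
  have hBE : B = E' := by
    refine lexPoly_injective hB hE' (max n K) (fun i hi => ?_) ?_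
    · rw [hBK i (by lia), hEn' i (by lia)]
    · rw [← lexPoly_eq_of_le (le_max_right n K) hBK, ← lexPoly_eq_of_le (le_max_left n K) hEn',
        ← hqE, hqb, ← hsum 0, gotzmannSum]
      simp_rw [add_zero]
  subst hBE
  refine ⟨∑ s ∈ Finset.range (B 0), w s, Nat.pos_of_ne_zero fun h0 => hne ?_, D, fun i hi => ?_⟩
  · rw [Finset.sum_eq_zero_iff] at h0
    refine eq_lexIdealGen fun w => hM.mem_iff_lexExp_le hn hB (hcells fun s hs => ?_) ha
    exact h0 s (Finset.mem_range.2 hs)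
  · rw [map_rename_castSucc_span_monomial, hilbFn_span_monomial,
      multiples_image_mapDomain_castSucc, hH' i hi, hsum 1,
      lexPoly_eq_of_le (le_max_right n K) hBK 1, lexPoly_eq_of_le (le_max_left n K) hEn' 1]
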